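/- Let R be a commutative ring, n ≥ 1, κ = (κ₁,…,κ_n) positive integers with N = κ₁+⋯+κ_n, and y₁,…,y_n ∈ R. Then det M(y,κ) = det G_∅(y,κ). -/

import Mathlib

open scoped BigOperators

/-- Complete homogeneous polynomial of degree `m` evaluated at the list `l`
(`h₀ = 1`, `h_m = 0` for `m < 0`). -/
def homEval {R : Type*} [CommRing R] (l : List R) (m : ℤ) : R :=
  if 0 ≤ m then
    ∑ f ∈ Finset.Nat.antidiagonalTuple l.length m.toNat, ∏ i, l.get i ^ f i
  else 0

/-- Elementary symmetric polynomial of degree `k` evaluated at the list `l`. -/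
def esymmEval {R : Type*} [CommRing R] (l : List R) (k : ℕ) : R :=
  (((l : Multiset R).powersetCard k).map Multiset.prod).sum

/-- Power sum of degree `s` evaluated at the list `l`. -/
def psumEval {R : Type*} [CommRing R] (l : List R) (s : ℕ) : R :=
  (l.map (· ^ s)).sum

/-- The list `y^[κ]`: `y q` repeated `κ q` times, in order. -/
def repList {R : Type*} {n : ℕ} (y : Fin n → R) (κ : Fin n → ℕ) : List R :=
  (List.ofFn fun q => List.replicate (κ q) (y q)).flatten

/-- Zero-based version of `γ(κ, p) = (q, r)`: the `p`-th entry (0-based) of the list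
    `(0,0),…,(0,κ₀−1),(1,0),…,(1,κ₁−1),…`. -/
def gammaPair (n : ℕ) (κ : Fin n → ℕ) (p : ℕ) : ℕ × ℕ :=
  ((List.ofFn fun q : Fin n => (List.range (κ q)).map fun r => ((q : ℕ), r)).flatten).getD p (0, 0)

/-- The generalized confluent Vandermonde matrix `G_λ(y, κ)` (zero-based indices):
`G[j,p] = binom(N+λ_j−j−1, r) · y_q^(N+λ_j−j−r−1)` if the exponent is `≥ 0`, else `0`,
where `(q, r) = gammaPair n κ p`. -/
def vanG (R : Type*) [CommRing R] {n : ℕ} (N : ℕ) (κ : Fin n → ℕ) (y : Fin n → R)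
    (lam : Fin N → ℕ) : Matrix (Fin N) (Fin N) R :=
  Matrix.of fun j p =>
    if h : (gammaPair n κ (p : ℕ)).1 < n ∧
        (j : ℕ) + (gammaPair n κ (p : ℕ)).2 + 1 ≤ N + lam j then
      (Nat.choose (N + lam j - ((j : ℕ) + 1)) (gammaPair n κ (p : ℕ)).2 : R) *
        y ⟨(gammaPair n κ (p : ℕ)).1, h.1⟩ ^
          (N + lam j - ((j : ℕ) + (gammaPair n κ (p : ℕ)).2 + 1))
    else 0

/-- The Jacobi–Trudi matrix `J_λ(x) = [h_{λ_j − j + k}(x)]`. -/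
def jacobiTrudi (R : Type*) [CommRing R] (N : ℕ) (lam : Fin N → ℕ) (x : List R) :
    Matrix (Fin N) (Fin N) R :=
  Matrix.of fun j k => homEval x ((lam j : ℤ) - (j : ℕ) + (k : ℕ))

/-- The matrix `M(y, κ)` with entries `(−1)^{N−k−r+1} e_{N−k−r+1}(y^[κ − r b_q])`
(in one-based form); entries with `N−k−r+1 < 0` are `0`. -/
def matM (R : Type*) [CommRing R] {n : ℕ} (N : ℕ) (κ : Fin n → ℕ) (y : Fin n → R) :
    Matrix (Fin N) (Fin N) R :=
  Matrix.of fun k p =>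
    if h : (gammaPair n κ (p : ℕ)).1 < n ∧
        (k : ℕ) + (gammaPair n κ (p : ℕ)).2 + 1 ≤ N then
      (-1 : R) ^ (N - ((k : ℕ) + (gammaPair n κ (p : ℕ)).2 + 1)) *
        esymmEval
          (repList y (Function.update κ ⟨(gammaPair n κ (p : ℕ)).1, h.1⟩
            (κ ⟨(gammaPair n κ (p : ℕ)).1, h.1⟩ - ((gammaPair n κ (p : ℕ)).2 + 1))))
          (N - ((k : ℕ) + (gammaPair n κ (p : ℕ)).2 + 1))
    else 0

/-- The column vector `H^N_{s,λ}(l) = (h_{s + λ_j − j}(l))_{j=1}^N` (one-based `j`). -/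
def Hcol {R : Type*} [CommRing R] {N : ℕ} (lam : Fin N → ℕ) (s : ℕ) (l : List R) :
    Fin N → R :=
  fun j => homEval l ((s : ℤ) + lam j - ((j : ℕ) + 1))

open PowerSeries in
/-- Up to sign, the elementary symmetric polynomials of `l` are the coefficients of
`∏ (1 - a X)`. -/
theorem coeff_prod_one_sub_C_mul_X {R : Type*} [CommRing R] (l : List R) (k : ℕ) :
    coeff k (l.map fun a => (1 - C a * X : R⟦X⟧)).prod = (-1) ^ k * esymmEval l k := by
  induction l generalizing k with
  | nil =>
    cases k with
    | zero => simp [esymmEval]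
    | succ k => simp [esymmEval, coeff_one, Multiset.powersetCard_zero_right]
  | cons a l ih =>
    rw [List.map_cons, List.prod_cons, sub_mul, one_mul, map_sub, mul_assoc, coeff_C_mul]
    cases k with
    | zero => simp [ih, esymmEval]
    | succ k =>
      rw [coeff_succ_X_mul, ih, ih]
      simp only [esymmEval, ← Multiset.cons_coe, Multiset.powersetCard_cons, Multiset.map_add,
        Multiset.sum_add, Multiset.map_map, Function.comp_def, Multiset.prod_cons,
        Multiset.sum_map_mul_left]
      ring

theorem prod_map_repList {R A : Type*} [CommMonoid A] {n : ℕ} (y : Fin n → R) (κ : Fin n → ℕ)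
    (f : R → A) : ((repList y κ).map f).prod = ∏ q, f (y q) ^ κ q := by
  simp [repList, List.map_flatten, List.prod_flatten, List.map_ofFn, Function.comp_def,
    List.prod_ofFn]

theorem gammaPair_spec {n : ℕ} {κ : Fin n → ℕ} {p : ℕ} (hp : p < ∑ q, κ q) :
    ∃ q : Fin n, ∃ r < κ q, gammaPair n κ p = (↑q, r) := by
  set L := (List.ofFn fun q : Fin n => (List.range (κ q)).map fun r => ((q : ℕ), r)).flatten
    with hL
  have hlen : L.length = ∑ q, κ q := by
    simp [hL, List.length_flatten, List.map_ofFn, Function.comp_def, List.sum_ofFn]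
  have hmem : gammaPair n κ p ∈ L := by
    rw [gammaPair, ← hL, List.getD_eq_getElem _ _ (hlen ▸ hp)]
    exact List.getElem_mem _
  simp only [hL, List.mem_flatten, List.mem_ofFn] at hmem
  obtain ⟨_, ⟨q, rfl⟩, h⟩ := hmem
  obtain ⟨r, hr, h⟩ := List.mem_map.mp h
  exact ⟨q, r, List.mem_range.mp hr, h.symm⟩

open PowerSeries in
theorem one_sub_C_mul_X_pow_mul_mk_choose {R : Type*} [CommRing R] (a : R) (r : ℕ) :
    (1 - C a * X) ^ (r + 1) * (mk fun m => ((m + r).choose r : R) * a ^ m) = 1 := by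
  have h := congrArg (rescale a) (mk_add_choose_mul_one_sub_pow_eq_one R r)
  rw [map_mul, map_pow, map_sub, map_one, rescale_X, mul_comm] at h
  convert h using 2
  ext m
  simp [coeff_rescale, mul_comm, add_comm]

open PowerSeries in
/-- The transition matrix from `G_∅(y, κ)` to `M(y, κ)`: row `k` lists the coefficients of
`X ^ k * ∏ q, (1 - y q * X) ^ κ q`. -/
noncomputable def confluentTransition {R : Type*} [CommRing R] {n : ℕ} (N : ℕ) (κ : Fin n → ℕ)
    (y : Fin n → R) : Matrix (Fin N) (Fin N) R :=
  Matrix.of fun k j => coeff (j : ℕ) (X ^ (k : ℕ) * ∏ q, (1 - C (y q) * X) ^ κ q)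

theorem det_confluentTransition {R : Type*} [CommRing R] {n : ℕ} (N : ℕ) (κ : Fin n → ℕ)
    (y : Fin n → R) : (confluentTransition N κ y).det = 1 := by
  rw [Matrix.det_of_isUpperTriangular]
  · simp [confluentTransition, PowerSeries.coeff_X_pow_mul', map_prod]
  · intro k j (hjk : j < k)
    simp [confluentTransition, PowerSeries.coeff_X_pow_mul', hjk]

open PowerSeries in
theorem matM_eq_confluentTransition_mul_vanG {R : Type*} [CommRing R] {n : ℕ} {N : ℕ}
    {κ : Fin n → ℕ} (hN : N = ∑ q, κ q) (y : Fin n → R) :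
    matM R N κ y = confluentTransition N κ y * vanG R N κ y fun _ => 0 := by
  ext k p
  obtain ⟨q, r, hr, hqr⟩ := gammaPair_spec (hN ▸ p.isLt : (p : ℕ) < ∑ q, κ q)
  obtain ⟨N, rfl⟩ : ∃ N', N = N' + 1 := ⟨N - 1, by have := p.isLt; omega⟩
  set S : R⟦X⟧ := mk fun m => ((m + r).choose r : R) * y q ^ m with hS
  set Q : R⟦X⟧ := ∏ i, (1 - C (y i) * X) ^ Function.update κ q (κ q - (r + 1)) i with hQ
  have hE : ∏ i, (1 - C (y i) * X) ^ κ i = Q * (1 - C (y q) * X) ^ (r + 1) := by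
    rw [hQ, ← Finset.mul_prod_erase _ _ (Finset.mem_univ q),
      ← Finset.mul_prod_erase (s := .univ) (a := q) _ (Finset.mem_univ q), Function.update_self,
      mul_right_comm, ← pow_add, Nat.sub_add_cancel hr]
    congr 1
    refine Finset.prod_congr rfl fun i hi => ?_
    rw [Function.update_of_ne (Finset.ne_of_mem_erase hi)]
  have hG (j : Fin (N + 1)) :
      vanG R (N + 1) κ y (fun _ => 0) j p = coeff (N - j) (X ^ r * S) := by
    simp only [vanG, Matrix.of_apply, hqr, coeff_X_pow_mul', hS, coeff_mk, Fin.is_lt, true_and,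
      Fin.eta, add_zero]
    by_cases h : (j : ℕ) + r + 1 ≤ N + 1
    · rw [dif_pos h, if_pos (by omega)]
      rw [show N + 1 - ((j : ℕ) + 1) = N - j - r + r by omega,
        show N + 1 - ((j : ℕ) + r + 1) = N - j - r by omega]
    · rw [dif_neg h, if_neg (by omega)]
  have hM : matM R (N + 1) κ y k p = coeff N (X ^ ((k : ℕ) + r) * Q) := by
    simp only [matM, Matrix.of_apply, hqr, coeff_X_pow_mul', Fin.is_lt, true_and, Fin.eta]
    by_cases h : (k : ℕ) + r + 1 ≤ N + 1
    · rw [dif_pos h, if_pos (by omega), ← coeff_prod_one_sub_C_mul_X, prod_map_repList,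
        Nat.add_sub_add_right]
    · rw [dif_neg h, if_neg (by omega)]
  have hprod : X ^ ((k : ℕ) + r) * Q =
      X ^ (k : ℕ) * (∏ i, (1 - C (y i) * X) ^ κ i) * (X ^ r * S) := by
    have hinv : (1 - C (y q) * X) ^ (r + 1) * S = 1 := one_sub_C_mul_X_pow_mul_mk_choose (y q) r
    rw [hE]
    linear_combination -(X ^ ((k : ℕ) + r) * Q) * hinv
  rw [hM, hprod, coeff_mul, Matrix.mul_apply, Finset.Nat.sum_antidiagonal_eq_sum_range_succ_mk,
    Finset.sum_range]
  exact Finset.sum_congr rfl fun j _ => by rw [hG, confluentTransition, Matrix.of_apply]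

/-- `det M(y,κ) = det G_∅(y,κ)`. -/
theorem matM_det_eq_confluent_vandermonde_det {R : Type*} [CommRing R]
    (n : ℕ) (hn : 1 ≤ n) (κ : Fin n → ℕ) (hκ : ∀ q, 0 < κ q)
    (N : ℕ) (hN : N = ∑ q, κ q) (y : Fin n → R) :
    (matM R N κ y).det = (vanG R N κ y fun _ => 0).det := by
  rw [matM_eq_confluentTransition_mul_vanG hN, Matrix.det_mul, det_confluentTransition, one_mul]
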